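/- For the canonical reduction of QCNF satisfiability to LTL model checking: given a closed QCNF Φ = Q x̄ (C₁ ∧ ... ∧ C_m) with n variables, the Kripke structure K and the LTL formula Ψ = ¬(Ψ_univ ∧ Ψ_cons) defined in the reduction satisfy: K ⊨ Ψ if and only if Φ is false. -/

import Mathlib

/- LTL in negation normal form (negation only on propositional variables), with
standard semantics over linear time structures `M : ℕ → Set P`. -/

inductive LTL (P : Type) : Type
  | tt : LTL P
  | ff : LTL P
  | var : P → LTL P
  | nvar : P → LTL P
  | and : LTL P → LTL P → LTL P
  | or : LTL P → LTL P → LTL P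
  | next : LTL P → LTL P
  | unt : LTL P → LTL P → LTL P   -- strong until U
  | wunt : LTL P → LTL P → LTL P  -- weak until W
  deriving DecidableEq

def Sat {P : Type} (M : ℕ → Set P) : LTL P → ℕ → Prop
  | .tt, _ => True
  | .ff, _ => False
  | .var p, i => p ∈ M i
  | .nvar p, i => p ∉ M i
  | .and a b, i => Sat M a i ∧ Sat M b i
  | .or a b, i => Sat M a i ∨ Sat M b i
  | .next a, i => Sat M a (i + 1)
  | .unt a b, i => ∃ j, i ≤ j ∧ Sat M b j ∧ ∀ k, i ≤ k → k < j → Sat M a k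
  | .wunt a b, i =>
      (∀ j, i ≤ j → Sat M a j) ∨ (∃ j, i ≤ j ∧ Sat M b j ∧ ∀ k, i ≤ k → k < j → Sat M a k)

def LTL.G {P : Type} (a : LTL P) : LTL P := .wunt a .ff
def LTL.F {P : Type} (a : LTL P) : LTL P := .unt .tt a

def bigAnd {P : Type} (l : List (LTL P)) : LTL P := l.foldr .and .tt
def bigOr {P : Type} (l : List (LTL P)) : LTL P := l.foldr .or .ff

/- Canonical reduction of QCNF satisfiability to LTL model checking (Demri–Schnoebelen).
The QCNF Φ = Q₁x₁…Qₙxₙ (C₁ ∧ … ∧ C_m) is given by `Q : Fin n → Bool` (true = ∀) and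
clauses `C : Fin m → List (Fin n × Bool)` (lists of literals). The states of the Kripke
structure K are also the propositional variables of the LTL formulas (each state is
labeled by its own proposition); variable `v : Fin n` corresponds to the 1-based
index i = v+1 of the paper. -/

inductive St (n m : ℕ) (C : Fin m → List (Fin n × Bool)) : Type
  | a : Fin (n + 1) → St n m C
  | b : Fin (n + 1) → St n m C
  | x : Fin n → Bool → St n m C
  | d : Fin m → St n m C
  | e : Fin m → St n m C
  | lt : (j : Fin m) → Fin (C j).length → St n m C

/-- The transition relation of K. -/
inductive Tr {n m : ℕ} {C : Fin m → List (Fin n × Bool)} (hm : 0 < m) :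
    St n m C → St n m C → Prop
  | b0a0 : Tr hm (.b 0) (.a 0)
  | ab (i : Fin (n + 1)) (h : i.val < n) : Tr hm (.a i) (.b ⟨i.val + 1, by omega⟩)
  | bx (v : Fin n) (ε : Bool) : Tr hm (.b v.succ) (.x v ε)
  | xa (v : Fin n) (ε : Bool) : Tr hm (.x v ε) (.a v.succ)
  | ad : Tr hm (.a (Fin.last n)) (.d ⟨0, hm⟩)
  | dl (j : Fin m) (k : Fin (C j).length) : Tr hm (.d j) (.lt j k)
  | le (j : Fin m) (k : Fin (C j).length) : Tr hm (.lt j k) (.e j)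
  | ed (j : Fin m) (h : j.val + 1 < m) : Tr hm (.e j) (.d ⟨j.val + 1, h⟩)
  | eb (j : Fin m) (h : j.val = m - 1) (i : Fin (n + 1)) : Tr hm (.e j) (.b i)

/-- Ψ_univ = ⋀_{i : Q_i = ∀} G(a_{i-1} ⇒ ((¬b_{i-1}) U x⁰_i) ∧ X²(x¹_i)). -/
def PsiUniv (n m : ℕ) (Q : Fin n → Bool) (C : Fin m → List (Fin n × Bool)) :
    LTL (St n m C) :=
  bigAnd ((List.finRange n).filterMap (fun v =>
    if Q v then
      some (LTL.G (.or (.nvar (St.a v.castSucc))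
        (.and (.unt (.nvar (St.b v.castSucc)) (.var (St.x v false)))
              (.next (.next (.var (St.x v true)))))))
    else none))

/-- Ψ_cons = ⋀_{(i,j,k,ε) : lit(x^ε_i) = ∼lit(l_{(j,k)})} G(x^ε_i ⇒ ((¬l_{(j,k)}) W b_i)). -/
def PsiCons (n m : ℕ) (C : Fin m → List (Fin n × Bool)) : LTL (St n m C) :=
  bigAnd ((List.finRange m).flatMap (fun j =>
    (List.finRange (C j).length).map (fun k =>
      let v := ((C j).get k).1
      let s := ((C j).get k).2
      LTL.G (.or (.nvar (St.x v (!s)))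
        (.wunt (.nvar (St.lt j k)) (.var (St.b v.succ)))))))

/-- Evaluation of the quantifier prefix of Φ over a matrix predicate. -/
def quantPrefix {n : ℕ} (Q : Fin n → Bool) (Pr : (Fin n → Bool) → Prop) :
    List (Fin n) → (Fin n → Bool) → Prop
  | [], σ => Pr σ
  | v :: rest, σ =>
    if Q v then ∀ bb : Bool, quantPrefix Q Pr rest (Function.update σ v bb)
    else ∃ bb : Bool, quantPrefix Q Pr rest (Function.update σ v bb)

def matrixTrue {n m : ℕ} (C : Fin m → List (Fin n × Bool)) (σ : Fin n → Bool) : Prop :=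
  ∀ j : Fin m, ∃ l ∈ C j, σ l.1 = l.2

section Helpers

lemma sat_bigAnd {P : Type} (M : ℕ → Set P) (l : List (LTL P)) (i : ℕ) :
    Sat M (bigAnd l) i ↔ ∀ φ ∈ l, Sat M φ i := by
  induction l with
  | nil => simp [bigAnd, Sat]
  | cons a l ih =>
    have : bigAnd (a :: l) = .and a (bigAnd l) := rfl
    rw [this]
    simp [Sat, ih]

lemma sat_G {P : Type} (M : ℕ → Set P) (a : LTL P) (i : ℕ) :
    Sat M (LTL.G a) i ↔ ∀ j, i ≤ j → Sat M a j := by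
  simp [LTL.G, Sat]

variable {n m : ℕ} {C : Fin m → List (Fin n × Bool)}

lemma sat_univ (Q : Fin n → Bool) (mp : ℕ → St n m C) :
    Sat (fun t => {mp t}) (PsiUniv n m Q C) 0 ↔
      ∀ v, Q v = true → ∀ t, mp t = .a v.castSucc →
        (∃ j, t ≤ j ∧ mp j = .x v false ∧ ∀ k, t ≤ k → k < j → mp k ≠ .b v.castSucc) ∧
        mp (t + 2) = .x v true := by
  unfold PsiUniv
  rw [sat_bigAnd]
  constructor
  · intro h v hv t ht
    have h1 := h _ (List.mem_filterMap.2 ⟨v, List.mem_finRange v, by rw [if_pos hv]⟩)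
    rw [sat_G] at h1
    have h2 := h1 t (Nat.zero_le _)
    simp only [Sat, Set.mem_singleton_iff] at h2
    rcases h2 with h2 | ⟨⟨j, h2, h3, h4⟩, h5⟩
    · exact absurd ht.symm h2
    · exact ⟨⟨j, h2, h3.symm, fun k a b => Ne.symm (h4 k a b)⟩, h5.symm⟩
  · intro h φ hφ
    obtain ⟨v, -, hv⟩ := List.mem_filterMap.1 hφ
    split_ifs at hv with hQ
    obtain rfl := Option.some.inj hv
    rw [sat_G]
    intro t _
    simp only [Sat, Set.mem_singleton_iff]
    by_cases ht : mp t = .a v.castSucc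
    · obtain ⟨⟨j, h2, h3, h4⟩, h5⟩ := h v hQ t ht
      exact Or.inr ⟨⟨j, h2, h3.symm, fun k a b => Ne.symm (h4 k a b)⟩, h5.symm⟩
    · exact Or.inl (Ne.symm ht)

lemma sat_cons (mp : ℕ → St n m C) :
    Sat (fun t => {mp t}) (PsiCons n m C) 0 ↔
      ∀ j, ∀ k : Fin (C j).length, ∀ t, mp t = .x ((C j).get k).1 (!((C j).get k).2) →
        (∀ r, t ≤ r → mp r ≠ .lt j k) ∨
        (∃ r, t ≤ r ∧ mp r = .b ((C j).get k).1.succ ∧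
          ∀ q, t ≤ q → q < r → mp q ≠ .lt j k) := by
  unfold PsiCons
  rw [sat_bigAnd]
  constructor
  · intro h j k t ht
    have h1 := h _ (List.mem_flatMap.2 ⟨j, List.mem_finRange j,
      List.mem_map.2 ⟨k, List.mem_finRange k, rfl⟩⟩)
    rw [sat_G] at h1
    have h2 := h1 t (Nat.zero_le _)
    simp only [Sat, Set.mem_singleton_iff] at h2
    rcases h2 with h2 | h2 | ⟨r, h2, h3, h4⟩
    · exact absurd ht.symm h2
    · exact Or.inl fun r a => Ne.symm (h2 r a)
    · exact Or.inr ⟨r, h2, h3.symm, fun k a b => Ne.symm (h4 k a b)⟩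
  · intro h φ hφ
    obtain ⟨j, -, hj⟩ := List.mem_flatMap.1 hφ
    obtain ⟨k, -, rfl⟩ := List.mem_map.1 hj
    simp only
    rw [sat_G]
    intro t _
    simp only [Sat, Set.mem_singleton_iff]
    by_cases ht : mp t = .x ((C j).get k).1 (!((C j).get k).2)
    · rcases h j k t ht with h2 | ⟨r, h2, h3, h4⟩
      · exact Or.inr (Or.inl fun r a => Ne.symm (h2 r a))
      · exact Or.inr (Or.inr ⟨r, h2, h3.symm, fun k a b => Ne.symm (h4 k a b)⟩)
    · exact Or.inl (Ne.symm ht)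

/-- Truth of the formula after the first `p` quantifiers are stripped. -/
def WW (Q : Fin n → Bool) (C : Fin m → List (Fin n × Bool)) (p : ℕ) (σ : Fin n → Bool) : Prop :=
  quantPrefix Q (matrixTrue C) ((List.finRange n).drop p) σ

lemma WW_last (Q : Fin n → Bool) (σ : Fin n → Bool) : WW Q C n σ ↔ matrixTrue C σ := by
  unfold WW
  rw [List.drop_of_length_le (by simp)]
  rfl

lemma WW_step (Q : Fin n → Bool) (v : Fin n) (σ : Fin n → Bool) :
    WW Q C v.val σ ↔ if Q v then ∀ bb : Bool, WW Q C (v.val + 1) (Function.update σ v bb)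
      else ∃ bb : Bool, WW Q C (v.val + 1) (Function.update σ v bb) := by
  unfold WW
  rw [List.drop_eq_getElem_cons (by simp)]
  simp [quantPrefix]

lemma WW_congr (Q : Fin n → Bool) (r p : ℕ) (hp : p + r = n) (σ τ : Fin n → Bool)
    (h : ∀ v : Fin n, v.val < p → σ v = τ v) (hW : WW Q C p σ) : WW Q C p τ := by
  induction r generalizing p σ τ with
  | zero =>
    have : σ = τ := funext fun v => h v (by omega)
    exact this ▸ hW
  | succ r ih =>
    have hlt : p < n := by omega
    have key : ∀ bb, WW Q C (p + 1) (Function.update σ ⟨p, hlt⟩ bb) →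
        WW Q C (p + 1) (Function.update τ ⟨p, hlt⟩ bb) := by
      intro bb
      apply ih (p + 1) (by omega)
      intro v hv
      by_cases e : v = ⟨p, hlt⟩
      · subst e; simp
      · rw [Function.update_of_ne e, Function.update_of_ne e]
        apply h
        have : v.val ≠ p := fun h => e (Fin.ext h)
        omega
    have s1 := WW_step (C := C) Q ⟨p, hlt⟩ σ
    have s2 := WW_step (C := C) Q ⟨p, hlt⟩ τ
    simp only at s1 s2
    rw [s2]
    rw [s1] at hW
    split_ifs at hW ⊢ with hQ
    · exact fun bb => key bb (hW bb)
    · obtain ⟨bb, hb⟩ := hW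
      exact ⟨bb, key bb hb⟩

/-! Soundness -/

/-- The current assignment along a path. -/
def cur (mp : ℕ → St n m C) : ℕ → Fin n → Bool
  | 0 => fun _ => false
  | t + 1 => match mp (t + 1) with
    | .x v ε => Function.update (cur mp t) v ε
    | _ => cur mp t

/-- Number of variables assigned in a state. -/
def lev : St n m C → ℕ
  | .a i => i.val
  | .b i => i.val - 1
  | .x v _ => v.val + 1
  | _ => n

lemma cur_inv {hm : 0 < m} (mp : ℕ → St n m C) (h0 : mp 0 = .b 0)
    (htr : ∀ t, Tr hm (mp t) (mp (t + 1))) (t : ℕ) :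
    ∀ v : Fin n, v.val < lev (mp t) → ∃ s, s ≤ t ∧ mp s = .x v (cur mp t v) ∧
      ∀ k, s ≤ k → k ≤ t → mp k ≠ .b v.succ := by
  induction t with
  | zero => intro v hv; rw [h0] at hv; simp [lev] at hv
  | succ t ih =>
    intro v hv
    have hT := htr t
    have ext : v.val < lev (mp t) → cur mp (t + 1) v = cur mp t v → mp (t + 1) ≠ .b v.succ →
        ∃ s, s ≤ t + 1 ∧ mp s = .x v (cur mp (t + 1) v) ∧
          ∀ k, s ≤ k → k ≤ t + 1 → mp k ≠ .b v.succ := by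
      intro h1 h2 h3
      obtain ⟨s, hs, hx, hk⟩ := ih v h1
      refine ⟨s, by omega, by rw [h2]; exact hx, fun k a b => ?_⟩
      rcases Nat.lt_or_ge k (t + 1) with h | h
      · exact hk k a (by omega)
      · obtain rfl : k = t + 1 := by omega
        exact h3
    generalize hs : mp t = s at *
    generalize hs' : mp (t + 1) = s' at *
    cases hT with
    | bx w ε =>
      by_cases e : v = w
      · subst e
        have : cur mp (t + 1) v = ε := by simp [cur, hs']
        refine ⟨t + 1, le_rfl, by rw [this, hs'], fun k a b => ?_⟩
        obtain rfl : k = t + 1 := by omega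
        rw [hs']; simp
      · refine ext ?_ ?_ (by simp)
        · have : v.val ≠ w.val := fun h => e (Fin.ext h)
          simp [lev] at hv ⊢; omega
        · simp [cur, hs', Function.update_of_ne e]
    | ab i h =>
      refine ext (by simpa [lev] using hv) (by simp [cur, hs']) ?_
      simp [lev] at hv
      simp [Fin.ext_iff]; omega
    | eb j h i =>
      refine ext (by simp [lev]) (by simp [cur, hs']) ?_
      simp [lev] at hv
      simp [Fin.ext_iff]; omega
    | b0a0 => simp [lev] at hv
    | _ => exact ext (by simp [lev] at hv ⊢ <;> omega) (by simp [cur, hs']) (by simp)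

lemma cur_lit {hm : 0 < m} (mp : ℕ → St n m C) (h0 : mp 0 = .b 0)
    (htr : ∀ t, Tr hm (mp t) (mp (t + 1)))
    (hc : Sat (fun t => {mp t}) (PsiCons n m C) 0) (t : ℕ) (j : Fin m)
    (k : Fin (C j).length) (ht : mp t = .lt j k) :
    cur mp t ((C j).get k).1 = ((C j).get k).2 := by
  by_contra hne
  rw [sat_cons] at hc
  obtain ⟨s, hs, hx, hk⟩ := cur_inv mp h0 htr t ((C j).get k).1 (by rw [ht]; simp [lev])
  have e : cur mp t ((C j).get k).1 = !((C j).get k).2 := by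
    revert hne
    generalize cur mp t ((C j).get k).1 = a
    generalize ((C j).get k).2 = b
    cases a <;> cases b <;> simp
  rw [e] at hx
  rcases hc j k s hx with h | ⟨r, h1, h2, h3⟩
  · exact h t hs ht
  · rcases Nat.lt_or_ge t r with h | h
    · exact h3 t hs h ht
    · exact hk r h1 h h2

lemma clause_run {hm : 0 < m} (mp : ℕ → St n m C)
    (htr : ∀ t, Tr hm (mp t) (mp (t + 1))) (t : ℕ) (ht : mp t = .a (Fin.last n)) (j : ℕ)
    (hj : j < m) : mp (t + 1 + 3 * j) = .d ⟨j, hj⟩ ∧ cur mp (t + 1 + 3 * j) = cur mp t := by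
  induction j with
  | zero =>
    have h := htr t
    rw [ht] at h
    generalize hs : mp (t + 1) = s at h
    cases h with
    | ab i h => simp at h
    | ad => simp [hs, cur]
  | succ j ih =>
    obtain ⟨h1, h2⟩ := ih (by omega)
    have e : t + 1 + 3 * (j + 1) = t + 1 + 3 * j + 1 + 1 + 1 := by ring
    rw [e]
    generalize t + 1 + 3 * j = q at *
    have a1 := htr q
    have a2 := htr (q + 1)
    have a3 := htr (q + 1 + 1)
    rw [h1] at a1
    generalize hs1 : mp (q + 1) = s1 at *
    cases a1 with
    | dl _ k =>
    generalize hs2 : mp (q + 1 + 1) = s2 at *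
    cases a2
    generalize hs3 : mp (q + 1 + 1 + 1) = s3 at *
    cases a3 with
    | ed _ h => simp [cur, hs1, hs2, hs3, h2]
    | eb _ h => simp at h; omega

lemma clause_lit {hm : 0 < m} (mp : ℕ → St n m C)
    (htr : ∀ t, Tr hm (mp t) (mp (t + 1))) (t : ℕ) (ht : mp t = .a (Fin.last n)) (j : Fin m) :
    ∃ q k, mp q = .lt j k ∧ cur mp q = cur mp t := by
  obtain ⟨h1, h2⟩ := clause_run mp htr t ht j.val j.isLt
  generalize t + 1 + 3 * j.val = q at *
  have a1 := htr q
  rw [h1] at a1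
  generalize hs1 : mp (q + 1) = s1 at *
  cases a1 with
  | dl _ k => exact ⟨q + 1, k, hs1, by simp [cur, hs1, h2]⟩

/-- States from which `b p` must be visited next. -/
def Low (p : ℕ) : St n m C → Prop
  | .a i => i.val < p
  | .b i => i.val ≤ p
  | .x v _ => v.val + 1 < p
  | _ => False

lemma low_step {hm : 0 < m} (p : Fin (n + 1)) (s s' : St n m C) (h : Tr hm s s')
    (hs : s ≠ .b p) (hl : Low p.val s) : Low p.val s' := by
  cases h with
  | bx v ε =>
    have : p.val ≠ v.val + 1 := fun h => hs (by congr 1; exact Fin.ext h.symm)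
    simp [Low] at hl ⊢; omega
  | b0a0 =>
    have : p.val ≠ 0 := fun h => hs (by congr 1; exact Fin.ext h.symm)
    simp only [Low, Fin.val_zero]; omega
  | ad => simp [Low] at hl ⊢; omega
  | _ => simp [Low] at hl ⊢ <;> omega

lemma cur_stable {hm : 0 < m} (mp : ℕ → St n m C)
    (htr : ∀ t, Tr hm (mp t) (mp (t + 1))) (p : Fin n) (t j : ℕ) (htj : t ≤ j)
    (hj : ¬ Low p.val (mp j))
    (hb : ∀ k, t ≤ k → k < j → mp k ≠ .b p.castSucc) :
    ∀ v : Fin n, v.val < p.val → cur mp j v = cur mp t v := by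
  have nl : ∀ k, t ≤ k → k ≤ j → ¬ Low p.val (mp k) := by
    intro k hk hkj hl
    apply hj
    induction j, hkj using Nat.le_induction with
    | base => exact hl
    | succ r hr ih =>
      have : Low p.val (mp r) := by
        by_contra hcon
        exact hcon (ih (by omega) hcon fun k a b => hb k a (by omega))
      exact low_step p.castSucc _ _ (htr r) (hb r (by omega) (by omega)) this
  intro v hv
  have : ∀ r, t + r ≤ j → cur mp (t + r) v = cur mp t v := by
    intro r
    induction r with
    | zero => intro _; rfl
    | succ r ih =>
      intro h
      rw [← ih (by omega)]
      have h1 := htr (t + r)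
      have h2 := nl (t + r) (by omega) (by omega)
      change cur mp (t + r + 1) v = _
      simp only [cur]
      generalize mp (t + r + 1) = s' at *
      generalize mp (t + r) = s at *
      cases h1 with
      | bx w ε =>
        simp [Low] at h2
        have : v ≠ w := by rintro rfl; omega
        simp [Function.update_of_ne this]
      | _ => rfl
  have := this (j - t) (by omega)
  rwa [Nat.add_sub_cancel' htj] at this

lemma next_x {hm : 0 < m} (mp : ℕ → St n m C)
    (htr : ∀ t, Tr hm (mp t) (mp (t + 1))) (t : ℕ) (v : Fin n) (ε : Bool)
    (h : mp t = .x v ε) : mp (t + 1) = .a v.succ ∧ cur mp (t + 1) = cur mp t := by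
  have h1 := htr t
  rw [h] at h1
  generalize hs : mp (t + 1) = s at *
  cases h1
  simp [cur, hs]

lemma cur_x {hm : 0 < m} (mp : ℕ → St n m C) (h0 : mp 0 = .b 0) (t : ℕ) (v : Fin n) (ε : Bool)
    (h : mp t = .x v ε) : cur mp t v = ε := by
  cases t with
  | zero => rw [h0] at h; simp at h
  | succ t => simp [cur, h]

lemma next_a {hm : 0 < m} (mp : ℕ → St n m C)
    (htr : ∀ t, Tr hm (mp t) (mp (t + 1))) (t : ℕ) (v : Fin n)
    (h : mp t = .a v.castSucc) : ∃ ε, mp (t + 2) = .x v ε ∧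
      ∀ w : Fin n, w.val < v.val → cur mp (t + 2) w = cur mp t w := by
  have h1 := htr t
  have h2 := htr (t + 1)
  rw [h] at h1
  generalize hs1 : mp (t + 1) = s1 at *
  have e : s1 = .b v.succ := by
    generalize hq : St.a v.castSucc = q at h1
    cases h1 with
    | ab i h =>
      simp at hq
      subst hq
      rfl
    | ad =>
      simp at hq
    | _ => simp at hq
  subst e
  change ∃ ε, mp (t + 1 + 1) = .x v ε ∧
      ∀ w : Fin n, w.val < v.val → cur mp (t + 1 + 1) w = cur mp t w
  generalize hs2 : mp (t + 1 + 1) = s2 at *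
  generalize hq : St.b v.succ = q at h2
  cases h2 with
  | bx w ε =>
    simp at hq
    subst hq
    refine ⟨ε, rfl, fun w hw => ?_⟩
    have : w ≠ v := by rintro rfl; omega
    simp [cur, hs1, hs2, Function.update_of_ne this]
  | b0a0 => exact absurd hq (by simp)
  | _ => simp at hq

lemma sound {hm : 0 < m} (Q : Fin n → Bool) (mp : ℕ → St n m C) (h0 : mp 0 = .b 0)
    (htr : ∀ t, Tr hm (mp t) (mp (t + 1)))
    (hc : Sat (fun t => {mp t}) (PsiCons n m C) 0)
    (hu : Sat (fun t => {mp t}) (PsiUniv n m Q C) 0) (r : ℕ) :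
    ∀ (i : Fin (n + 1)), i.val + r = n → ∀ t, mp t = .a i → WW Q C i.val (cur mp t) := by
  induction r with
  | zero =>
    intro i hi t ht
    obtain rfl : i = Fin.last n := Fin.ext (by simpa using hi)
    rw [Fin.val_last, WW_last]
    intro j
    obtain ⟨q, k, h1, h2⟩ := clause_lit mp htr t ht j
    have := cur_lit mp h0 htr hc q j k h1
    exact ⟨(C j).get k, List.get_mem _ _, by rw [← h2, this]⟩
  | succ r ih =>
    intro i hi t ht
    obtain ⟨v, rfl⟩ : ∃ v : Fin n, i = v.castSucc := ⟨⟨i.val, by omega⟩, rfl⟩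
    have key : ∀ q ε, mp q = .x v ε → (∀ w : Fin n, w.val < v.val → cur mp q w = cur mp t w) →
        WW Q C (v.val + 1) (Function.update (cur mp t) v ε) := by
      intro q ε hq hag
      obtain ⟨h1, h2⟩ := next_x mp htr q v ε hq
      have h3 := ih v.succ (by simp at hi ⊢; omega) _ h1
      refine WW_congr Q r _ (by simp at hi ⊢; omega) _ _ ?_ h3
      intro w hw
      rw [h2]
      by_cases e : w = v
      · subst e
        simp [cur_x (hm := hm) mp h0 q w ε hq]
      · rw [Function.update_of_ne e]
        apply hag
        have : w.val ≠ v.val := fun h => e (Fin.ext h)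
        omega
    change WW Q C v.val _
    rw [WW_step]
    obtain ⟨ε, hx, hag⟩ := next_a mp htr t v ht
    have k1 := key _ _ hx hag
    split_ifs with hQ
    · rw [sat_univ] at hu
      obtain ⟨⟨j, hj1, hj2, hj3⟩, hj4⟩ := hu v hQ t ht
      rw [hj4] at hx
      have e : true = ε := by simpa using hx
      subst e
      have k2 := key _ _ hj2 (cur_stable mp htr v t j hj1 (by rw [hj2]; simp [Low]) hj3)
      intro bb
      cases bb
      · exact k2
      · exact k1
    · exact ⟨ε, k1⟩

/-! Completeness -/

open Classical in
/-- The choice made for variable `v`. -/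
noncomputable def pick (Q : Fin n → Bool) (C : Fin m → List (Fin n × Bool))
    (σ : Fin n → Bool) (v : Fin n) : Bool :=
  if Q v then true else decide (WW Q C (v.val + 1) (Function.update σ v true))

open Classical in
/-- The literal chosen in clause `j`. -/
noncomputable def pickLit (hne : ∀ j, C j ≠ []) (σ : Fin n → Bool) (j : Fin m) :
    Fin (C j).length :=
  if h : ∃ k, σ ((C j).get k).1 = ((C j).get k).2 then h.choose
  else ⟨0, List.length_pos_iff.2 (hne j)⟩

/-- `v` is the last universal variable set to true. -/
def IsBack (Q : Fin n → Bool) (σ : Fin n → Bool) (v : Fin n) : Prop :=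
  Q v = true ∧ σ v = true ∧ ∀ w, v < w → Q w = true → σ w = false

lemma IsBack.unique {Q : Fin n → Bool} {σ : Fin n → Bool} {v w : Fin n} (h1 : IsBack Q σ v)
    (h2 : IsBack Q σ w) : v = w := by
  rcases lt_trichotomy v w with h | h | h
  · have := h1.2.2 w h h2.1
    rw [h2.2.1] at this; simp at this
  · exact h
  · have := h2.2.2 v h h1.1
    rw [h1.2.1] at this; simp at this

open Classical in
/-- One step of the deterministic exploration of the strategy tree. -/
noncomputable def stp (hm : 0 < m) (Q : Fin n → Bool) (hne : ∀ j, C j ≠ []) :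
    St n m C × (Fin n → Bool) → St n m C × (Fin n → Bool)
  | (.a i, σ) =>
    if h : i.val < n then
      (.b ⟨i.val + 1, by omega⟩, Function.update σ ⟨i.val, h⟩ (pick Q C σ ⟨i.val, h⟩))
    else (.d ⟨0, hm⟩, σ)
  | (.b i, σ) => if h : i = 0 then (.a 0, σ) else (.x (i.pred h) (σ (i.pred h)), σ)
  | (.x v _, σ) => (.a v.succ, σ)
  | (.d j, σ) => (.lt j (pickLit hne σ j), σ)
  | (.lt j _, σ) => (.e j, σ)
  | (.e j, σ) =>
    if h : j.val + 1 < m then (.d ⟨j.val + 1, h⟩, σ)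
    else if h : ∃ v, IsBack Q σ v then
      (.b h.choose.succ, Function.update σ h.choose false)
    else (.b 0, σ)

variable (hm : 0 < m) (Q : Fin n → Bool) (hne : ∀ j, C j ≠ [])

lemma stp_a (v : Fin n) (σ : Fin n → Bool) :
    stp hm Q hne (.a v.castSucc, σ) = (.b v.succ, Function.update σ v (pick Q C σ v)) := by
  simp only [stp, Fin.val_castSucc, v.isLt, dif_pos]
  rfl

lemma stp_last (σ : Fin n → Bool) :
    stp hm Q hne (.a (Fin.last n), σ) = (.d ⟨0, hm⟩, σ) := by
  simp [stp]

lemma stp_b (v : Fin n) (σ : Fin n → Bool) :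
    stp hm Q hne (.b v.succ, σ) = (.x v (σ v), σ) := by
  simp [stp]

lemma stp_back (j : Fin m) (hj : j.val + 1 = m) (σ : Fin n → Bool) (v : Fin n)
    (hv : IsBack Q σ v) :
    stp hm Q hne (.e j, σ) = (.b v.succ, Function.update σ v false) := by
  have h : ∃ v, IsBack Q σ v := ⟨v, hv⟩
  have e : h.choose = v := h.choose_spec.unique hv
  simp only [stp]
  rw [dif_neg (by omega), dif_pos h, e]

lemma stp_tr (c : St n m C × (Fin n → Bool)) : Tr hm c.1 (stp hm Q hne c).1 := by
  obtain ⟨s, σ⟩ := c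
  cases s with
  | a i =>
    simp only [stp]
    split_ifs with h
    · exact Tr.ab i h
    · obtain rfl : i = Fin.last n := Fin.ext (by simp; omega)
      exact Tr.ad
  | b i =>
    refine Fin.cases ?_ (fun v => ?_) i
    · simp [stp]; exact Tr.b0a0
    · rw [stp_b]; exact Tr.bx v _
  | x v ε => exact Tr.xa v ε
  | d j => exact Tr.dl j _
  | lt j k => exact Tr.le j k
  | e j =>
    simp only [stp]
    split_ifs with h h'
    · exact Tr.ed j h
    · exact Tr.eb j (by omega) _
    · exact Tr.eb j (by omega) _

/-- Invariant of the exploration. -/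
def Iv (Q : Fin n → Bool) : St n m C × (Fin n → Bool) → Prop
  | (.a i, σ) => ∀ p ≤ i.val, WW Q C p σ
  | (.b i, σ) => ∀ p ≤ i.val, WW Q C p σ
  | (.x v ε, σ) => ε = σ v ∧ ∀ p ≤ v.val + 1, WW Q C p σ
  | (.lt j k, σ) => σ ((C j).get k).1 = ((C j).get k).2 ∧ ∀ p ≤ n, WW Q C p σ
  | (_, σ) => ∀ p ≤ n, WW Q C p σ

lemma WW_update (v : Fin n) (σ : Fin n → Bool) (b : Bool) (p : ℕ) (hp : p ≤ v.val)
    (h : WW Q C p σ) : WW Q C p (Function.update σ v b) := by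
  refine WW_congr Q (n - p) p (by omega) _ _ ?_ h
  intro w hw
  rw [Function.update_of_ne]
  rintro rfl
  omega

lemma pick_spec (v : Fin n) (σ : Fin n → Bool) (h : WW Q C v.val σ) :
    WW Q C (v.val + 1) (Function.update σ v (pick Q C σ v)) := by
  rw [WW_step] at h
  unfold pick
  split_ifs at h ⊢ with hQ
  · exact h _
  · by_cases h' : WW Q C (v.val + 1) (Function.update σ v true)
    · simp [h']
    · obtain ⟨bb, hb⟩ := h
      cases bb
      · simpa [h'] using hb
      · exact absurd hb h'

lemma stp_inv (c : St n m C × (Fin n → Bool)) (h : Iv Q c) : Iv Q (stp hm Q hne c) := by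
  obtain ⟨s, σ⟩ := c
  cases s with
  | a i =>
    refine Fin.lastCases ?_ (fun v => ?_) i h
    · intro h
      rw [stp_last]
      exact h
    · intro h
      rw [stp_a]
      intro p hp
      simp only [Iv, Fin.val_castSucc, Fin.val_succ] at h hp
      rcases Nat.lt_or_ge v.val p with h' | h'
      · obtain rfl : p = v.val + 1 := by omega
        exact pick_spec Q v σ (h _ le_rfl)
      · exact WW_update Q v σ _ p h' (h p h')
  | b i =>
    refine Fin.cases ?_ (fun v => ?_) i h
    · intro h
      simp only [stp, dif_pos]
      exact h
    · intro h
      rw [stp_b]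
      exact ⟨rfl, h⟩
  | x v ε => exact h.2
  | d j =>
    refine ⟨?_, h⟩
    have hM := (WW_last Q σ).1 (h n le_rfl) j
    have : ∃ k, σ ((C j).get k).1 = ((C j).get k).2 := by
      obtain ⟨l, hl, hs⟩ := hM
      obtain ⟨k, rfl⟩ := List.get_of_mem hl
      exact ⟨k, hs⟩
    unfold pickLit
    rw [dif_pos this]
    exact this.choose_spec
  | lt j k => exact h.2
  | e j =>
    by_cases h1 : j.val + 1 < m
    · simp only [stp, dif_pos h1]
      exact h
    · by_cases h2 : ∃ v, IsBack Q σ v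
      · obtain ⟨v, hv⟩ := h2
        rw [stp_back hm Q hne j (by omega) σ v hv]
        intro p hp
        simp only [Iv, Fin.val_succ] at h hp
        rcases Nat.lt_or_ge v.val p with h' | h'
        · obtain rfl : p = v.val + 1 := by omega
          have := h v.val (by omega)
          rw [WW_step, if_pos hv.1] at this
          exact this false
        · exact WW_update Q v σ _ p h' (h p (by omega))
      · simp only [stp, dif_neg h1, dif_neg h2]
        intro p hp
        exact h p (by simp at hp; omega)

lemma stp_sigma (c : St n m C × (Fin n → Bool)) (v : Fin n)
    (h : (stp hm Q hne c).1 ≠ .b v.succ) : (stp hm Q hne c).2 v = c.2 v := by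
  obtain ⟨s, σ⟩ := c
  cases s with
  | a i =>
    revert h
    refine Fin.lastCases ?_ (fun w => ?_) i
    · intro h
      rw [stp_last]
    · rw [stp_a]
      intro h
      have : v ≠ w := by rintro rfl; exact h rfl
      simp [Function.update_of_ne this]
  | b i =>
    simp only [stp]
    split_ifs <;> rfl
  | x v ε => rfl
  | d j => rfl
  | lt j k => rfl
  | e j =>
    revert h
    simp only [stp]
    split_ifs with h1 h2
    · intro; rfl
    · intro h
      have : v ≠ h2.choose := by
        intro e; apply h; rw [← e]
      simp [Function.update_of_ne this]
    · intro; rfl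

/-- One step avoiding `b u` for `u ≤ p` in the target. -/
def Av (p : ℕ) (c c' : St n m C × (Fin n → Bool)) : Prop :=
  c' = stp hm Q hne c ∧ ∀ u : Fin (n + 1), u.val ≤ p → c'.1 ≠ .b u

lemma av_mono {p q : ℕ} (hpq : q ≤ p) {c c' : St n m C × (Fin n → Bool)}
    (h : Relation.ReflTransGen (Av hm Q hne p) c c') :
    Relation.ReflTransGen (Av hm Q hne q) c c' :=
  h.lift id (fun _ _ h => ⟨h.1, fun u hu => h.2 u (by omega)⟩)

lemma av_one (p : ℕ) {c c' : St n m C × (Fin n → Bool)} (h : stp hm Q hne c = c')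
    (h' : ∀ u : Fin (n + 1), u.val ≤ p → c'.1 ≠ .b u) :
    Relation.ReflTransGen (Av hm Q hne p) c c' :=
  Relation.ReflTransGen.single ⟨h.symm, h'⟩

lemma av_clauses (p : ℕ) (σ : Fin n → Bool) (j : ℕ) (hj : j < m) :
    Relation.ReflTransGen (Av hm Q hne p) (.a (Fin.last n), σ) (.e ⟨j, hj⟩, σ) := by
  have de : ∀ j : Fin m, Relation.ReflTransGen (Av hm Q hne p) (.d j, σ) (.e j, σ) := fun j =>
    (av_one hm Q hne p (c' := (.lt j (pickLit hne σ j), σ)) rfl (by simp)).trans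
      (av_one hm Q hne p rfl (by simp))
  induction j with
  | zero => exact (av_one hm Q hne p (stp_last hm Q hne σ) (by simp)).trans (de _)
  | succ j ih =>
    refine (ih (by omega)).trans (Relation.ReflTransGen.trans ?_ (de _))
    refine av_one hm Q hne p ?_ (by simp)
    simp [stp, hj]

lemma av_b (v : Fin n) (σ : Fin n → Bool) :
    Relation.ReflTransGen (Av hm Q hne v.val) (.b v.succ, σ) (.a v.succ, σ) :=
  (av_one hm Q hne _ (stp_b hm Q hne v σ) (by simp)).trans (av_one hm Q hne _ rfl (by simp))

lemma ne_b (v : Fin n) (u : Fin (n + 1)) (hu : u.val ≤ v.val) :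
    (St.b v.succ : St n m C) ≠ .b u := by
  intro h
  simp at h
  subst h
  simp at hu

lemma av_full (r : ℕ) : ∀ i : Fin (n + 1), i.val + r = n → ∀ σ : Fin n → Bool,
    ∃ σ' : Fin n → Bool, Relation.ReflTransGen (Av hm Q hne i.val) (.a i, σ)
        (.e ⟨m - 1, by omega⟩, σ') ∧
      (∀ w : Fin n, w.val < i.val → σ' w = σ w) ∧
      (∀ w : Fin n, i.val ≤ w.val → Q w = true → σ' w = false) := by
  induction r with
  | zero =>
    intro i hi σ
    obtain rfl : i = Fin.last n := Fin.ext (by simpa using hi)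
    exact ⟨σ, av_clauses hm Q hne _ σ _ _, fun _ _ => rfl, fun w hw => by
      simp at hw; omega⟩
  | succ r ih =>
    intro i hi σ
    obtain ⟨v, rfl⟩ : ∃ v : Fin n, i = v.castSucc := ⟨⟨i.val, by omega⟩, rfl⟩
    have hv : v.succ.val + r = n := by simp at hi ⊢; omega
    have s1 : Relation.ReflTransGen (Av hm Q hne v.val) (.a v.castSucc, σ)
        (.a v.succ, Function.update σ v (pick Q C σ v)) :=
      (av_one hm Q hne _ (stp_a hm Q hne v σ) (ne_b v)).trans (av_b hm Q hne v _)
    obtain ⟨τ, h1, h2, h3⟩ := ih v.succ hv (Function.update σ v (pick Q C σ v))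
    have s2 := s1.trans (av_mono hm Q hne (q := v.val) (by simp) h1)
    have hτ : τ v = pick Q C σ v := by rw [h2 v (by simp)]; simp
    have hlow : ∀ w : Fin n, w.val < v.val → τ w = σ w := by
      intro w hw
      rw [h2 w (by simp; omega), Function.update_of_ne]
      rintro rfl; omega
    by_cases hQ : Q v = true
    · have hback : IsBack Q τ v := by
        refine ⟨hQ, by rw [hτ]; simp [pick, hQ], fun w hw => h3 w ?_⟩
        have : v.val < w.val := hw
        simp; omega
      have s3 := s2.trans ((av_one hm Q hne v.val
        (stp_back hm Q hne ⟨m - 1, by omega⟩ (by simp; omega) τ v hback) (ne_b v)).trans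
          (av_b hm Q hne v _))
      obtain ⟨τ', h1', h2', h3'⟩ := ih v.succ hv (Function.update τ v false)
      refine ⟨τ', s3.trans (av_mono hm Q hne (q := v.val) (by simp) h1'), ?_, ?_⟩
      · intro w hw
        simp at hw
        rw [h2' w (by simp; omega), Function.update_of_ne (by rintro rfl; omega), hlow w hw]
      · intro w hw hQw
        by_cases e : w = v
        · subst e
          rw [h2' w (by simp)]; simp
        · have : w.val ≠ v.val := fun h => e (Fin.ext h)
          exact h3' w (by simp at hw ⊢; omega) hQw
    · refine ⟨τ, s2, hlow, ?_⟩
      intro w hw hQw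
      have : w ≠ v := by rintro rfl; exact hQ hQw
      have : w.val ≠ v.val := fun h => this (Fin.ext h)
      exact h3 w (by simp at hw ⊢; omega) hQw

lemma av_univ (v : Fin n) (hQ : Q v = true) (σ : Fin n → Bool) :
    ∃ σ', Relation.ReflTransGen (Av hm Q hne v.val) (.a v.castSucc, σ) (.x v false, σ') := by
  have s1 : Relation.ReflTransGen (Av hm Q hne v.val) (.a v.castSucc, σ)
      (.a v.succ, Function.update σ v (pick Q C σ v)) :=
    (av_one hm Q hne _ (stp_a hm Q hne v σ) (ne_b v)).trans (av_b hm Q hne v _)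
  obtain ⟨τ, h1, h2, h3⟩ := av_full hm Q hne (n - (v.val + 1)) v.succ
    (by rw [Fin.val_succ]; omega)
    (Function.update σ v (pick Q C σ v))
  have s2 := s1.trans (av_mono hm Q hne (q := v.val) (by simp) h1)
  have hτ : τ v = pick Q C σ v := by rw [h2 v (by simp)]; simp
  have hback : IsBack Q τ v := by
    refine ⟨hQ, by rw [hτ]; simp [pick, hQ], fun w hw => h3 w ?_⟩
    have : v.val < w.val := hw
    simp; omega
  refine ⟨Function.update τ v false, s2.trans ((av_one hm Q hne v.val
    (stp_back hm Q hne ⟨m - 1, by omega⟩ (by simp; omega) τ v hback) (ne_b v)).trans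
      (av_one hm Q hne _ ?_ (by simp)))⟩
  rw [stp_b]; simp

lemma av_path (p : ℕ) (c : ℕ → St n m C × (Fin n → Bool))
    (hc : ∀ t, c (t + 1) = stp hm Q hne (c t)) (t : ℕ) (c' : St n m C × (Fin n → Bool))
    (h : Relation.ReflTransGen (Av hm Q hne p) (c t) c') :
    ∃ j, t ≤ j ∧ c j = c' ∧
      ∀ k, t < k → k ≤ j → ∀ u : Fin (n + 1), u.val ≤ p → (c k).1 ≠ .b u := by
  induction h with
  | refl => exact ⟨t, le_rfl, rfl, fun k a b => by omega⟩
  | tail _ h2 ih =>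
    obtain ⟨j, h3, h4, h5⟩ := ih
    have e := (hc j).trans ((congrArg _ h4).trans h2.1.symm)
    refine ⟨j + 1, by omega, e, fun k a b => ?_⟩
    rcases Nat.lt_or_ge k (j + 1) with h | h
    · exact h5 k a (by omega)
    · obtain rfl : k = j + 1 := by omega
      rw [e]
      exact h2.2

lemma complete (hne : ∀ j, C j ≠ []) (hW : WW Q C 0 (fun _ => false)) :
    ∃ mp : ℕ → St n m C, mp 0 = .b 0 ∧ (∀ t, Tr hm (mp t) (mp (t + 1))) ∧
      Sat (fun t => {mp t}) (.and (PsiUniv n m Q C) (PsiCons n m C)) 0 := by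
  obtain ⟨c, hc0, hc⟩ : ∃ c : ℕ → St n m C × (Fin n → Bool), c 0 = (.b 0, fun _ => false) ∧
      ∀ t, c (t + 1) = stp hm Q hne (c t) :=
    ⟨fun t => (stp hm Q hne)^[t] (.b 0, fun _ => false), rfl,
      fun t => Function.iterate_succ_apply' _ _ _⟩
  have hI : ∀ t, Iv Q (c t) := by
    intro t
    induction t with
    | zero =>
      rw [hc0]
      intro p hp
      obtain rfl : p = 0 := by simpa using hp
      exact hW
    | succ t ih => rw [hc]; exact stp_inv hm Q hne _ ih
  refine ⟨fun t => (c t).1, by simp [hc0], fun t => ?_, ?_, ?_⟩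
  · simp only [hc]
    exact stp_tr hm Q hne _
  · rw [sat_univ]
    intro v hQ t ht
    obtain ⟨σ, hσ⟩ : ∃ σ, c t = (.a v.castSucc, σ) := ⟨(c t).2, Prod.ext ht rfl⟩
    constructor
    · obtain ⟨σ', h⟩ := av_univ hm Q hne v hQ σ
      rw [← hσ] at h
      obtain ⟨j, h1, h2, h3⟩ := av_path hm Q hne _ c hc t _ h
      refine ⟨j, h1, by simp [h2], fun k a b => ?_⟩
      rcases Nat.lt_or_ge t k with h | h
      · exact h3 k h (by omega) _ (by simp)
      · obtain rfl : k = t := by omega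
        simp [hσ]
    · change (c (t + 1 + 1)).1 = _
      rw [hc, hc, hσ, stp_a, stp_b]
      simp [pick, hQ]
  · rw [sat_cons]
    intro j k t ht
    have hst : c t = (.x ((C j).get k).1 (!((C j).get k).2), (c t).2) := Prod.ext ht rfl
    have hval : (c t).2 ((C j).get k).1 = !((C j).get k).2 := by
      have := hI t
      rw [hst] at this
      exact this.1.symm
    have stab : ∀ r, (∀ q, t ≤ q → q ≤ t + r → (c q).1 ≠ .b ((C j).get k).1.succ) →
        (c (t + r)).2 ((C j).get k).1 = !((C j).get k).2 := by
      intro r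
      induction r with
      | zero => intro _; exact hval
      | succ r ih =>
        intro h
        rw [← ih fun q a b => h q a (by omega)]
        have := h (t + r + 1) (by omega) (by omega)
        change (c (t + r + 1)).2 _ = _
        rw [hc] at this ⊢
        exact stp_sigma hm Q hne _ _ this
    have nolt : ∀ r, t ≤ r → (∀ q, t ≤ q → q ≤ r → (c q).1 ≠ .b ((C j).get k).1.succ) →
        (c r).1 ≠ .lt j k := by
      intro r hr h hlt
      have h1 := stab (r - t) (by rw [Nat.add_sub_cancel' hr]; exact h)
      rw [Nat.add_sub_cancel' hr] at h1
      have h2 := hI r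
      have h3 : c r = (.lt j k, (c r).2) := Prod.ext hlt rfl
      rw [h3] at h2
      have h4 := h2.1
      rw [h1] at h4
      revert h4
      generalize ((C j).get k).2 = b
      cases b <;> simp
    classical
    by_cases hex : ∃ r, t ≤ r ∧ (c r).1 = .b ((C j).get k).1.succ
    · right
      refine ⟨Nat.find hex, (Nat.find_spec hex).1, (Nat.find_spec hex).2, fun q a b => ?_⟩
      refine nolt q a fun q' a' b' h => ?_
      exact Nat.find_min hex (lt_of_le_of_lt b' b) ⟨a', h⟩
    · left
      intro r hr
      refine nolt r hr fun q a _ h => hex ⟨q, a, h⟩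

end Helpers

/-- K ⊨ Ψ (where Ψ = ¬(Ψ_univ ∧ Ψ_cons), i.e. no infinite path of K from b₀ satisfies
Ψ_univ ∧ Ψ_cons) iff Φ is false. -/
theorem stmt16 (n m : ℕ) (hm : 0 < m) (Q : Fin n → Bool)
    (C : Fin m → List (Fin n × Bool)) (hne : ∀ j, C j ≠ []) :
    (∀ mp : ℕ → St n m C, mp 0 = .b 0 → (∀ t, Tr hm (mp t) (mp (t + 1))) →
      ¬ Sat (fun t => {mp t}) (.and (PsiUniv n m Q C) (PsiCons n m C)) 0) ↔
    ¬ quantPrefix Q (matrixTrue C) (List.finRange n) (fun _ => false) := by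
  have hW : quantPrefix Q (matrixTrue C) (List.finRange n) (fun _ => false) ↔
      WW Q C 0 (fun _ => false) := by simp [WW]
  rw [hW]
  constructor
  · intro h hw
    obtain ⟨mp, h0, htr, hs⟩ := complete hm Q hne hw
    exact h mp h0 htr hs
  · intro h mp h0 htr hs
    apply h
    have h1 : mp 1 = .a 0 := by
      have h2 := htr 0
      rw [h0] at h2
      change Tr hm _ (mp 1) at h2
      generalize mp 1 = s at h2
      generalize hq : (St.b 0 : St n m C) = q at h2
      cases h2 with
      | b0a0 => rfl
      | bx v ε =>
        simp only [St.b.injEq] at hq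
        exact absurd hq.symm (Fin.succ_ne_zero v)
      | _ => simp at hq
    have := sound Q mp h0 htr hs.2 hs.1 n 0 (by simp) 1 h1
    exact WW_congr Q n 0 (by simp) _ _ (by simp) this
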